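/- For every r-dimensional subspace W of ℂ^{p+q} there exist ω ∈ 𝕋 and invertible upper triangular matrices b₁ (of size p×p) and b₂ (of size q×q) such that W is the image of [ω] under the block-diagonal linear map diag(b₁,b₂). Moreover ω is unique up to right multiplication by an r×r permutation matrix: if ω, ω′ ∈ 𝕋 both have this property for the same W, then ω′ = ω P for some r×r permutation matrix P. -/

import Mathlib

open scoped Classical
open Matrix

noncomputable section

/-- A partial permutation matrix: entries in `{0,1}`, at most one `1` in each row
and in each column. -/
def IsPartialPerm {m n : ℕ} (τ : Matrix (Fin m) (Fin n) ℂ) : Prop :=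
  (∀ i j, τ i j = 0 ∨ τ i j = 1) ∧
  (∀ i j j', τ i j = 1 → τ i j' = 1 → j = j') ∧
  (∀ i i' j, τ i j = 1 → τ i' j = 1 → i = i')

/-- `(p+q) × r` complex matrices, rows indexed by `Fin p ⊕ Fin q`. -/
abbrev MatT (p q r : ℕ) := Matrix (Fin p ⊕ Fin q) (Fin r) ℂ

/-- The set `𝕋`: `(p+q) × r` matrices of rank `r` whose top `p × r` and bottom
`q × r` blocks are partial permutation matrices. -/
def InT {p q r : ℕ} (ω : MatT p q r) : Prop :=
  ω.rank = r ∧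
  IsPartialPerm (Matrix.of fun (i : Fin p) (c : Fin r) => ω (Sum.inl i) c) ∧
  IsPartialPerm (Matrix.of fun (j : Fin q) (c : Fin r) => ω (Sum.inr j) c)

/-- The permutation matrix of `w`: `(P_w)_{i,j} = 1` iff `i = w j`. -/
def permMat {r : ℕ} (w : Equiv.Perm (Fin r)) : Matrix (Fin r) (Fin r) ℂ :=
  Matrix.of fun i j => if i = w j then 1 else 0

/-- `[ω]`, the column space of `ω`, as a subspace of `ℂ^{p+q}`. -/
def colSpace {p q r : ℕ} (ω : MatT p q r) : Submodule ℂ (Fin p ⊕ Fin q → ℂ) :=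
  LinearMap.range ω.mulVecLin

/-- One more than the largest index of a nonzero coordinate of `x`, and `0` if `x = 0`. -/
def lead {n : ℕ} (x : Fin n → ℂ) : ℕ :=
  (Finset.univ.filter fun i => x i ≠ 0).sup fun i => (i : ℕ) + 1

lemma lead_le_iff {n : ℕ} {x : Fin n → ℂ} {k : ℕ} :
    lead x ≤ k ↔ ∀ i : Fin n, k ≤ i → x i = 0 := by
  simp only [lead, Finset.sup_le_iff, Finset.mem_filter, Finset.mem_univ, true_and]
  refine forall_congr' fun i => ⟨fun h hk => ?_, fun h hx => ?_⟩
  · by_contra hx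
    have := h hx
    omega
  · by_contra hk
    exact hx (h (by omega))

lemma eq_zero_of_lead_le {n : ℕ} {x : Fin n → ℂ} {i : Fin n} (h : lead x ≤ i) : x i = 0 :=
  lead_le_iff.1 h i le_rfl

lemma eq_zero_of_lead_eq_zero {n : ℕ} {x : Fin n → ℂ} (h : lead x = 0) : x = 0 :=
  funext fun _ => eq_zero_of_lead_le (by omega)

lemma exists_lead_eq {n : ℕ} {x : Fin n → ℂ} (h : lead x ≠ 0) :
    ∃ i : Fin n, lead x = i + 1 ∧ x i ≠ 0 := by
  have hne : (Finset.univ.filter fun i => x i ≠ 0).Nonempty := by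
    by_contra hne
    rw [Finset.not_nonempty_iff_eq_empty] at hne
    exact h (by simp [lead, hne])
  obtain ⟨i, hi, hs⟩ := Finset.exists_mem_eq_sup _ hne fun i : Fin n => (i : ℕ) + 1
  exact ⟨i, hs, by simpa using hi⟩

lemma ne_zero_of_lead_eq {n : ℕ} {x : Fin n → ℂ} {i : Fin n} (h : lead x = i + 1) :
    x i ≠ 0 := by
  obtain ⟨j, hj, hx⟩ := exists_lead_eq (x := x) (by omega)
  rwa [show i = j from Fin.ext (by omega)]

lemma lead_sub_smul_le {n : ℕ} {x y : Fin n → ℂ} (a : ℂ) (h : lead x ≤ lead y) :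
    lead (y - a • x) ≤ lead y := by
  refine lead_le_iff.2 fun i hi => ?_
  simp [eq_zero_of_lead_le hi, eq_zero_of_lead_le (h.trans hi)]

lemma exists_lead_sub_smul_lt {n : ℕ} {x y : Fin n → ℂ} (h : lead x = lead y)
    (hy : lead y ≠ 0) : ∃ a : ℂ, lead (y - a • x) < lead y := by
  obtain ⟨i, hi, -⟩ := exists_lead_eq hy
  have hx := ne_zero_of_lead_eq (h.trans hi)
  refine ⟨y i / x i, ?_⟩
  rw [hi, Nat.lt_succ_iff, lead_le_iff]
  intro j hj
  rcases eq_or_ne i j with rfl | hij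
  · simp [hx]
  · have : (i : ℕ) ≠ j := fun h => hij (Fin.ext h)
    have hyj : y j = 0 := eq_zero_of_lead_le (by omega)
    have hxj : x j = 0 := eq_zero_of_lead_le (by omega)
    simp [hyj, hxj]

/-- Nonzero members of the family have pairwise distinct leading positions. -/
def LeadInjective {n r : ℕ} (x : Fin r → Fin n → ℂ) : Prop :=
  ∀ c c', lead (x c) ≠ 0 → lead (x c) = lead (x c') → c = c'

/-- A family with distinct leading positions is the image of the columns of a partial permutation
matrix under an invertible upper triangular matrix. -/
lemma LeadInjective.exists_mul_eq {n r : ℕ} {x : Fin r → Fin n → ℂ} (hx : LeadInjective x) :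
    ∃ (b : Matrix (Fin n) (Fin n) ℂ) (τ : Matrix (Fin n) (Fin r) ℂ),
      IsUnit b ∧ b.BlockTriangular id ∧ IsPartialPerm τ ∧ b * τ = Matrix.of fun i c => x c i := by
  let b : Matrix (Fin n) (Fin n) ℂ := Matrix.of fun i j =>
    if h : ∃ c, lead (x c) = j + 1 then x h.choose i else if i = j then 1 else 0
  have hb : ∀ i (j : Fin n) c, lead (x c) = j + 1 → b i j = x c i := by
    intro i j c hc
    have h : ∃ c, lead (x c) = j + 1 := ⟨c, hc⟩
    have : h.choose = c := hx _ _ (by rw [h.choose_spec]; omega) (by rw [h.choose_spec, hc])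
    simp only [b, Matrix.of_apply, dif_pos h, this]
  have hb' : ∀ i (j : Fin n), (¬ ∃ c, lead (x c) = j + 1) → b i j = if i = j then 1 else 0 := by
    intro i j h
    simp only [b, Matrix.of_apply, dif_neg h]
  have htri : b.BlockTriangular id := by
    intro i j hij
    have hij : j < i := hij
    by_cases h : ∃ c, lead (x c) = j + 1
    · obtain ⟨c, hc⟩ := h
      rw [hb i j c hc]
      exact eq_zero_of_lead_le (by rw [hc]; exact hij)
    · rw [hb' i j h, if_neg hij.ne']
  refine ⟨b, Matrix.of fun i c => if lead (x c) = i + 1 then 1 else 0, ?_, htri, ⟨?_, ?_, ?_⟩, ?_⟩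
  · rw [Matrix.isUnit_iff_isUnit_det, Matrix.det_of_isUpperTriangular htri, isUnit_iff_ne_zero,
      Finset.prod_ne_zero_iff]
    intro i _
    by_cases h : ∃ c, lead (x c) = i + 1
    · obtain ⟨c, hc⟩ := h
      rw [hb i i c hc]
      exact ne_zero_of_lead_eq hc
    · simp [hb' i i h]
  · intro i c
    by_cases h : lead (x c) = i + 1 <;> simp [h]
  · intro i c c' h h'
    simp only [Matrix.of_apply, ite_eq_left_iff, zero_ne_one, imp_false, not_not] at h h'
    exact hx _ _ (by omega) (by omega)
  · intro i i' c h h'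
    simp only [Matrix.of_apply, ite_eq_left_iff, zero_ne_one, imp_false, not_not] at h h'
    exact Fin.ext (by omega)
  · ext i c
    simp only [Matrix.mul_apply, Matrix.of_apply, mul_ite, mul_one, mul_zero]
    by_cases h : lead (x c) = 0
    · rw [eq_zero_of_lead_eq_zero h]
      rw [eq_zero_of_lead_eq_zero h] at h
      simp [h]
    · obtain ⟨j, hj, -⟩ := exists_lead_eq h
      rw [Finset.sum_eq_single j, if_pos hj, hb i j c hj]
      · intro k _ hk
        rw [if_neg]
        intro hk'
        exact hk (Fin.ext (by omega))
      · simp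

lemma span_range_update_sub_smul {K V ι : Type*} [Field K] [AddCommGroup V] [Module K V]
    [DecidableEq ι] (w : ι → V) {c d : ι} (hcd : c ≠ d) (a : K) :
    Submodule.span K (Set.range (Function.update w d (w d - a • w c))) =
      Submodule.span K (Set.range w) := by
  have hmem : ∀ (v : ι → V) e, v e ∈ Submodule.span K (Set.range v) :=
    fun v e => Submodule.subset_span ⟨e, rfl⟩
  apply le_antisymm <;> rw [Submodule.span_le] <;> rintro _ ⟨e, rfl⟩
  · by_cases he : e = d
    · subst he
      simpa using sub_mem (hmem w e) (Submodule.smul_mem _ a (hmem w c))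
    · simpa [he] using hmem w e
  · have h := hmem (Function.update w d (w d - a • w c))
    by_cases he : e = d
    · subst he
      have h1 := h e
      have h2 := h c
      rw [Function.update_self] at h1
      rw [Function.update_of_ne hcd] at h2
      simpa using add_mem h1 (Submodule.smul_mem _ a h2)
    · have h1 := h e
      rwa [Function.update_of_ne he] at h1

/-- The leading positions of the two components of a vector. -/
def biLead {p q : ℕ} (v : Fin p ⊕ Fin q → ℂ) : ℕ × ℕ :=
  (lead fun i => v (Sum.inl i), lead fun j => v (Sum.inr j))

/-- Any `r`-dimensional subspace has a spanning family of size `r` whose two families of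
components both have distinct leading positions. -/
lemma exists_span_leadInjective {p q r : ℕ} (W : Submodule ℂ (Fin p ⊕ Fin q → ℂ))
    (hW : Module.finrank ℂ W = r) :
    ∃ w : Fin r → Fin p ⊕ Fin q → ℂ, Submodule.span ℂ (Set.range w) = W ∧
      LeadInjective (fun c i => w c (Sum.inl i)) ∧ LeadInjective (fun c j => w c (Sum.inr j)) := by
  let m : (Fin p ⊕ Fin q → ℂ) → ℕ := fun v => (biLead v).1 + (biLead v).2
  let S : Set (Fin r → Fin p ⊕ Fin q → ℂ) := {w | Submodule.span ℂ (Set.range w) = W}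
  have hS : S.Nonempty := by
    let b := Module.finBasisOfFinrankEq ℂ W hW
    refine ⟨fun c => (b c : Fin p ⊕ Fin q → ℂ), ?_⟩
    have h : Set.range (fun c => (b c : Fin p ⊕ Fin q → ℂ)) = W.subtype '' Set.range b := by
      rw [← Set.range_comp]; rfl
    change Submodule.span ℂ (Set.range fun c => (b c : Fin p ⊕ Fin q → ℂ)) = W
    rw [h, Submodule.span_image, b.span_eq, Submodule.map_subtype_top]
  let w := Function.argminOn (fun w : Fin r → Fin p ⊕ Fin q → ℂ => ∑ c, m (w c)) S hS
  have hw : w ∈ S := Function.argminOn_mem _ S hS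
  have hmin : ∀ c d (a : ℂ), c ≠ d → m (w d) ≤ m (w d - a • w c) := by
    intro c d a hcd
    by_contra! hlt
    have hmem : Function.update w d (w d - a • w c) ∈ S :=
      (span_range_update_sub_smul w hcd a).trans hw
    refine absurd (Function.argminOn_le (fun w : Fin r → Fin p ⊕ Fin q → ℂ => ∑ c, m (w c))
      S hmem) (not_le.2 (Finset.sum_lt_sum (fun e _ => ?_) ⟨d, Finset.mem_univ _, ?_⟩))
    · by_cases he : e = d
      · subst he
        simpa using hlt.le
      · simp [he, w]
    · simpa using hlt
  refine ⟨w, hw, ?_, ?_⟩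
  · have key : ∀ c d, lead (fun i => w d (Sum.inl i)) ≠ 0 →
        lead (fun i => w c (Sum.inl i)) = lead (fun i => w d (Sum.inl i)) →
        lead (fun j => w c (Sum.inr j)) ≤ lead (fun j => w d (Sum.inr j)) → c = d := by
      intro c d h0 h hle
      by_contra hcd
      obtain ⟨a, ha⟩ := exists_lead_sub_smul_lt h h0
      exact (hmin c d a hcd).not_gt (add_lt_add_of_lt_of_le ha (lead_sub_smul_le a hle))
    intro c d h0 h
    rcases le_total (lead fun j => w c (Sum.inr j)) (lead fun j => w d (Sum.inr j)) with hle | hle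
    · exact key c d (h ▸ h0) h hle
    · exact (key d c h0 h.symm hle).symm
  · have key : ∀ c d, lead (fun j => w d (Sum.inr j)) ≠ 0 →
        lead (fun j => w c (Sum.inr j)) = lead (fun j => w d (Sum.inr j)) →
        lead (fun i => w c (Sum.inl i)) ≤ lead (fun i => w d (Sum.inl i)) → c = d := by
      intro c d h0 h hle
      by_contra hcd
      obtain ⟨a, ha⟩ := exists_lead_sub_smul_lt h h0
      exact (hmin c d a hcd).not_gt (add_lt_add_of_le_of_lt (lead_sub_smul_le a hle) ha)
    intro c d h0 h
    rcases le_total (lead fun i => w c (Sum.inl i)) (lead fun i => w d (Sum.inl i)) with hle | hle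
    · exact key c d (h ▸ h0) h hle
    · exact (key d c h0 h.symm hle).symm

lemma exists_inT_map_colSpace_eq {p q r : ℕ} (W : Submodule ℂ (Fin p ⊕ Fin q → ℂ))
    (hW : Module.finrank ℂ W = r) :
    ∃ (ω : MatT p q r) (b₁ : Matrix (Fin p) (Fin p) ℂ) (b₂ : Matrix (Fin q) (Fin q) ℂ),
      InT ω ∧ IsUnit b₁ ∧ b₁.BlockTriangular id ∧ IsUnit b₂ ∧ b₂.BlockTriangular id ∧
      W = Submodule.map (Matrix.fromBlocks b₁ 0 0 b₂).mulVecLin (colSpace ω) := by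
  obtain ⟨w, hw, h₁, h₂⟩ := exists_span_leadInjective W hW
  obtain ⟨b₁, τ₁, hu₁, ht₁, hp₁, hm₁⟩ := h₁.exists_mul_eq
  obtain ⟨b₂, τ₂, hu₂, ht₂, hp₂, hm₂⟩ := h₂.exists_mul_eq
  have hmap : W = Submodule.map (Matrix.fromBlocks b₁ 0 0 b₂).mulVecLin
      (colSpace (Matrix.fromRows τ₁ τ₂)) := by
    rw [colSpace, ← LinearMap.range_comp, ← Matrix.mulVecLin_mul, Matrix.fromBlocks_mul_fromRows,
      Matrix.range_mulVecLin, ← hw]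
    congr 2
    ext c (i | j)
    · simp [hm₁, Matrix.col]
    · simp [hm₂, Matrix.col]
  refine ⟨Matrix.fromRows τ₁ τ₂, b₁, b₂,
    ⟨le_antisymm ((Matrix.rank_le_card_width _).trans_eq (Fintype.card_fin r)) ?_, hp₁, hp₂⟩,
    hu₁, ht₁, hu₂, ht₂, hmap⟩
  calc r = Module.finrank ℂ W := hW.symm
    _ ≤ Module.finrank ℂ (colSpace (Matrix.fromRows τ₁ τ₂)) := by
      rw [hmap]; exact Submodule.finrank_map_le _ _

/-- The vectors whose components are supported on the first `k.1` and the first `k.2`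
coordinates respectively. -/
def flagSpace (p q : ℕ) (k : ℕ × ℕ) : Submodule ℂ (Fin p ⊕ Fin q → ℂ) where
  carrier := {v | biLead v ≤ k}
  zero_mem' := Prod.mk_le_mk.2 ⟨lead_le_iff.2 fun _ _ => rfl, lead_le_iff.2 fun _ _ => rfl⟩
  add_mem' := by
    intro x y hx hy
    simp only [Set.mem_ofPred_eq, biLead, Prod.le_def, lead_le_iff, Pi.add_apply] at hx hy ⊢
    exact ⟨fun i hi => by simp [hx.1 i hi, hy.1 i hi], fun i hi => by simp [hx.2 i hi, hy.2 i hi]⟩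
  smul_mem' := by
    intro a x hx
    simp only [Set.mem_ofPred_eq, biLead, Prod.le_def, lead_le_iff, Pi.smul_apply] at hx ⊢
    exact ⟨fun i hi => by simp [hx.1 i hi], fun i hi => by simp [hx.2 i hi]⟩

lemma mem_flagSpace {p q : ℕ} {k : ℕ × ℕ} {v : Fin p ⊕ Fin q → ℂ} :
    v ∈ flagSpace p q k ↔ biLead v ≤ k := Iff.rfl

lemma lead_mulVec_le {n : ℕ} {b : Matrix (Fin n) (Fin n) ℂ} (hb : b.BlockTriangular id)
    (x : Fin n → ℂ) : lead (b *ᵥ x) ≤ lead x := by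
  refine lead_le_iff.2 fun i hi => ?_
  rw [Matrix.mulVec, dotProduct]
  refine Finset.sum_eq_zero fun j _ => ?_
  rcases lt_or_ge j i with h | h
  · simp [hb (show id j < id i from h)]
  · simp [eq_zero_of_lead_le (hi.trans (show (i : ℕ) ≤ j from h))]

lemma finrank_map_fromBlocks_inf_flagSpace {p q : ℕ} {b₁ : Matrix (Fin p) (Fin p) ℂ}
    {b₂ : Matrix (Fin q) (Fin q) ℂ} (hu₁ : IsUnit b₁) (ht₁ : b₁.BlockTriangular id)
    (hu₂ : IsUnit b₂) (ht₂ : b₂.BlockTriangular id) (U : Submodule ℂ (Fin p ⊕ Fin q → ℂ))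
    (k : ℕ × ℕ) :
    Module.finrank ℂ ↥(U.map (Matrix.fromBlocks b₁ 0 0 b₂).mulVecLin ⊓ flagSpace p q k) =
      Module.finrank ℂ ↥(U ⊓ flagSpace p q k) := by
  have hinj : Function.Injective (Matrix.fromBlocks b₁ 0 0 b₂).mulVecLin := by
    apply Matrix.mulVec_injective_of_isUnit
    rw [Matrix.isUnit_iff_isUnit_det] at hu₁ hu₂ ⊢
    rw [Matrix.det_fromBlocks_zero₂₁]
    exact hu₁.mul hu₂
  have hle : (flagSpace p q k).map (Matrix.fromBlocks b₁ 0 0 b₂).mulVecLin ≤ flagSpace p q k := by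
    rintro _ ⟨v, hv, rfl⟩
    have hv : biLead v ≤ k := hv
    refine mem_flagSpace.2 (le_trans ?_ hv)
    rw [Matrix.mulVecLin_apply, Matrix.fromBlocks_mulVec]
    simp only [Matrix.zero_mulVec, add_zero, zero_add]
    exact ⟨lead_mulVec_le ht₁ _, lead_mulVec_le ht₂ _⟩
  have heq := Submodule.eq_of_le_of_finrank_eq hle
    (Submodule.equivMapOfInjective _ hinj _).finrank_eq.symm
  rw [show U.map (Matrix.fromBlocks b₁ 0 0 b₂).mulVecLin ⊓ flagSpace p q k =
    (U ⊓ flagSpace p q k).map (Matrix.fromBlocks b₁ 0 0 b₂).mulVecLin by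
      rw [Submodule.map_inf _ hinj, heq]]
  exact (Submodule.equivMapOfInjective _ hinj _).finrank_eq.symm

lemma IsPartialPerm.lead_eq_iff {n r : ℕ} {τ : Matrix (Fin n) (Fin r) ℂ} (hτ : IsPartialPerm τ)
    (i : Fin n) (c : Fin r) : lead (fun i => τ i c) = i + 1 ↔ τ i c = 1 := by
  have key : ∀ j : Fin n, lead (fun i => τ i c) = j + 1 → τ j c = 1 := fun j h =>
    (hτ.1 j c).resolve_left (ne_zero_of_lead_eq (x := fun i => τ i c) h)
  refine ⟨key i, fun h => ?_⟩
  obtain ⟨j, hj, -⟩ := exists_lead_eq (x := fun i => τ i c) fun h0 => by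
    have := congrFun (eq_zero_of_lead_eq_zero h0) i
    simp [h] at this
  rw [hj, hτ.2.2 i j c h (key j hj)]

lemma IsPartialPerm.mulVec_apply {n r : ℕ} {τ : Matrix (Fin n) (Fin r) ℂ} (hτ : IsPartialPerm τ)
    {i : Fin n} {c : Fin r} (h : τ i c = 1) (x : Fin r → ℂ) : (τ *ᵥ x) i = x c := by
  rw [Matrix.mulVec, dotProduct, Finset.sum_eq_single c, h, one_mul]
  · intro d _ hd
    rw [(hτ.1 i d).resolve_right fun hd' => hd (hτ.2.1 i d c hd' h), zero_mul]
  · simp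

lemma IsPartialPerm.lead_mulVec_le_iff {n r : ℕ} {τ : Matrix (Fin n) (Fin r) ℂ}
    (hτ : IsPartialPerm τ) (x : Fin r → ℂ) (k : ℕ) :
    lead (τ *ᵥ x) ≤ k ↔ ∀ c, x c ≠ 0 → lead (fun i => τ i c) ≤ k := by
  refine ⟨fun h c hx => ?_, fun h => lead_le_iff.2 fun i hi => ?_⟩
  · by_contra! hk
    obtain ⟨i, hi, -⟩ := exists_lead_eq (x := fun i => τ i c) (by omega)
    refine hx ?_
    rw [← hτ.mulVec_apply ((hτ.lead_eq_iff i c).1 hi) x]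
    exact lead_le_iff.1 h i (by omega)
  · rw [Matrix.mulVec, dotProduct]
    refine Finset.sum_eq_zero fun c _ => ?_
    by_cases hx : x c = 0
    · rw [hx, mul_zero]
    · rw [lead_le_iff.1 (h c hx) i hi, zero_mul]

namespace InT

variable {p q r : ℕ} {ω ω' : MatT p q r}

lemma mulVecLin_injective (hω : InT ω) : Function.Injective ω.mulVecLin := by
  rw [← LinearMap.ker_eq_bot, ← Submodule.finrank_eq_zero (R := ℂ)]
  have h := ω.mulVecLin.finrank_range_add_finrank_ker
  have h' : Module.finrank ℂ (LinearMap.range ω.mulVecLin) = r := hω.1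
  rw [Module.finrank_fin_fun] at h
  omega

lemma biLead_col_injective (hω : InT ω) : Function.Injective fun c => biLead (ω.col c) := by
  intro c d h
  have h₁ : lead (fun i => ω (Sum.inl i) c) = lead (fun i => ω (Sum.inl i) d) :=
    congrArg Prod.fst h
  have h₂ : lead (fun j => ω (Sum.inr j) c) = lead (fun j => ω (Sum.inr j) d) :=
    congrArg Prod.snd h
  by_cases h₁0 : lead (fun i => ω (Sum.inl i) c) = 0
  · by_cases h₂0 : lead (fun j => ω (Sum.inr j) c) = 0
    · have hz : ω *ᵥ Pi.single c 1 = ω *ᵥ 0 := by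
        rw [Matrix.mulVec_single_one, Matrix.mulVec_zero]
        ext (i | j)
        · exact congrFun (eq_zero_of_lead_eq_zero h₁0) i
        · exact congrFun (eq_zero_of_lead_eq_zero h₂0) j
      have := congrFun (hω.mulVecLin_injective hz) c
      simp at this
    · obtain ⟨j, hj, -⟩ := exists_lead_eq h₂0
      exact hω.2.2.2.1 j c d ((hω.2.2.lead_eq_iff j c).1 hj)
        ((hω.2.2.lead_eq_iff j d).1 (h₂.symm.trans hj))
  · obtain ⟨i, hi, -⟩ := exists_lead_eq h₁0
    exact hω.2.1.2.1 i c d ((hω.2.1.lead_eq_iff i c).1 hi)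
      ((hω.2.1.lead_eq_iff i d).1 (h₁.symm.trans hi))

lemma biLead_mulVec_le_iff (hω : InT ω) (x : Fin r → ℂ) (k : ℕ × ℕ) :
    biLead (ω *ᵥ x) ≤ k ↔ ∀ c, ¬ biLead (ω.col c) ≤ k → x c = 0 := by
  have h := and_congr (hω.2.1.lead_mulVec_le_iff x k.1) (hω.2.2.lead_mulVec_le_iff x k.2)
  rw [← forall_and] at h
  refine h.trans (forall_congr' fun c => ?_)
  rw [← imp_and, ← not_imp_comm]
  exact Iff.rfl

lemma finrank_colSpace_inf_flagSpace (hω : InT ω) (k : ℕ × ℕ) :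
    Module.finrank ℂ ↥(colSpace ω ⊓ flagSpace p q k) =
      (Finset.univ.filter fun c => biLead (ω.col c) ≤ k).card := by
  let I : Set (Fin r) := {c | biLead (ω.col c) ≤ k}
  have h : colSpace ω ⊓ flagSpace p q k =
      (⨅ c ∈ Iᶜ, LinearMap.ker (LinearMap.proj c : (Fin r → ℂ) →ₗ[ℂ] ℂ)).map ω.mulVecLin := by
    ext v
    simp only [Submodule.mem_inf, colSpace, LinearMap.mem_range, mem_flagSpace, Submodule.mem_map,
      Submodule.mem_iInf, LinearMap.mem_ker, LinearMap.proj_apply, Matrix.mulVecLin_apply]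
    constructor
    · rintro ⟨⟨x, rfl⟩, hx⟩
      exact ⟨x, (hω.biLead_mulVec_le_iff x k).1 hx, rfl⟩
    · rintro ⟨x, hx, rfl⟩
      exact ⟨⟨x, rfl⟩, (hω.biLead_mulVec_le_iff x k).2 hx⟩
  rw [h, ← (Submodule.equivMapOfInjective _ hω.mulVecLin_injective _).finrank_eq,
    (LinearMap.iInfKerProjEquiv ℂ (fun _ : Fin r => ℂ) disjoint_compl_right
      (Set.union_compl_self I).ge).finrank_eq, Module.finrank_fintype_fun_eq_card]
  exact Fintype.card_subtype _

end InT

/-- A finite subset of a partial order is determined by the sizes of its intersections with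
principal lower sets. -/
lemma Finset.eq_of_card_filter_le_eq {α : Type*} [PartialOrder α] [DecidableLE α] {s t : Finset α}
    (h : ∀ k, (s.filter (· ≤ k)).card = (t.filter (· ≤ k)).card) : s = t := by
  by_contra hst
  obtain ⟨k, hk⟩ := (symmDiff s t).exists_minimal (by
    rwa [Finset.nonempty_iff_ne_empty, ← Finset.bot_eq_empty, Ne, symmDiff_eq_bot])
  have hlt : ∀ y, y < k → (y ∈ s ↔ y ∈ t) := by
    intro y hy
    by_contra hne
    exact hk.not_prop_of_lt hy (by rw [Finset.mem_symmDiff]; tauto)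
  have hss : ∀ {u v : Finset α}, (∀ y, y < k → (y ∈ u ↔ y ∈ v)) → k ∈ u → k ∉ v →
      (v.filter (· ≤ k)).card < (u.filter (· ≤ k)).card := by
    intro u v huv hu hv
    refine Finset.card_lt_card (Finset.ssubset_iff_of_subset ?_ |>.2
      ⟨k, by simp [hu], by simp [hv]⟩)
    intro y hy
    rw [Finset.mem_filter] at hy ⊢
    exact ⟨(huv y (lt_of_le_of_ne hy.2 fun e => hv (e ▸ hy.1))).2 hy.1, hy.2⟩
  rcases Finset.mem_symmDiff.1 hk.prop with ⟨hs, ht⟩ | ⟨ht, hs⟩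
  · exact (hss hlt hs ht).ne' (h k)
  · exact (hss (fun y hy => (hlt y hy).symm) ht hs).ne (h k)

lemma IsPartialPerm.eq_of_lead_eq {n r : ℕ} {τ τ' : Matrix (Fin n) (Fin r) ℂ}
    (hτ : IsPartialPerm τ) (hτ' : IsPartialPerm τ') {c d : Fin r}
    (h : lead (fun i => τ i c) = lead (fun i => τ' i d)) (i : Fin n) : τ i c = τ' i d := by
  have hi : τ i c = 1 ↔ τ' i d = 1 := by rw [← hτ.lead_eq_iff, ← hτ'.lead_eq_iff, h]
  rcases hτ.1 i c with h0 | h1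
  · rw [h0, (hτ'.1 i d).resolve_right fun h1 => by simp [h0] at hi; exact hi h1]
  · rw [h1, hi.1 h1]

lemma InT.exists_eq_mul_permMat {p q r : ℕ} {ω ω' : MatT p q r} (hω : InT ω) (hω' : InT ω')
    (h : ∀ k, Module.finrank ℂ ↥(colSpace ω ⊓ flagSpace p q k) =
      Module.finrank ℂ ↥(colSpace ω' ⊓ flagSpace p q k)) :
    ∃ w : Equiv.Perm (Fin r), ω' = ω * permMat w := by
  have himage : Finset.univ.image (fun c => biLead (ω.col c)) =
      Finset.univ.image fun c => biLead (ω'.col c) := by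
    refine Finset.eq_of_card_filter_le_eq fun k => ?_
    rw [Finset.filter_image, Finset.filter_image,
      Finset.card_image_of_injective _ hω.biLead_col_injective,
      Finset.card_image_of_injective _ hω'.biLead_col_injective,
      ← hω.finrank_colSpace_inf_flagSpace, ← hω'.finrank_colSpace_inf_flagSpace, h]
  have hex : ∀ c, ∃ d, biLead (ω.col d) = biLead (ω'.col c) := fun c => by
    have : biLead (ω'.col c) ∈ Finset.univ.image fun c => biLead (ω.col c) := by
      rw [himage]; exact Finset.mem_image_of_mem _ (Finset.mem_univ c)
    simpa using this
  choose w hw using hex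
  have hinj : Function.Injective w := fun c d hcd =>
    hω'.biLead_col_injective ((hw c).symm.trans ((congrArg _ (congrArg ω.col hcd)).trans (hw d)))
  refine ⟨Equiv.ofBijective w (Finite.injective_iff_bijective.1 hinj), ?_⟩
  ext (i | j) c
  · simpa [Matrix.mul_apply, permMat] using
      (hω.2.1.eq_of_lead_eq hω'.2.1 (congrArg Prod.fst (hw c)) i).symm
  · simpa [Matrix.mul_apply, permMat] using
      (hω.2.2.eq_of_lead_eq hω'.2.2 (congrArg Prod.snd (hw c)) j).symm

/-- every `r`-dimensional subspace `W ⊆ ℂ^{p+q}` is the image of `[ω]`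
under some `diag(b₁,b₂)` with `b₁, b₂` invertible upper triangular and `ω ∈ 𝕋`;
`ω` is unique up to a permutation of its columns. -/
theorem grassmannian_BK_orbit_parametrization (p q r : ℕ) (hr : r ≤ p + q)
    (W : Submodule ℂ (Fin p ⊕ Fin q → ℂ)) (hW : Module.finrank ℂ ↥W = r) :
    (∃ (ω : MatT p q r) (b₁ : Matrix (Fin p) (Fin p) ℂ) (b₂ : Matrix (Fin q) (Fin q) ℂ),
        InT ω ∧ IsUnit b₁ ∧ b₁.BlockTriangular id ∧ IsUnit b₂ ∧ b₂.BlockTriangular id ∧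
        W = Submodule.map (Matrix.fromBlocks b₁ 0 0 b₂).mulVecLin (colSpace ω)) ∧
    (∀ ω ω' : MatT p q r, InT ω → InT ω' →
      (∃ (b₁ : Matrix (Fin p) (Fin p) ℂ) (b₂ : Matrix (Fin q) (Fin q) ℂ),
        IsUnit b₁ ∧ b₁.BlockTriangular id ∧ IsUnit b₂ ∧ b₂.BlockTriangular id ∧
        W = Submodule.map (Matrix.fromBlocks b₁ 0 0 b₂).mulVecLin (colSpace ω)) →
      (∃ (b₁ : Matrix (Fin p) (Fin p) ℂ) (b₂ : Matrix (Fin q) (Fin q) ℂ),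
        IsUnit b₁ ∧ b₁.BlockTriangular id ∧ IsUnit b₂ ∧ b₂.BlockTriangular id ∧
        W = Submodule.map (Matrix.fromBlocks b₁ 0 0 b₂).mulVecLin (colSpace ω')) →
      ∃ w : Equiv.Perm (Fin r), ω' = ω * permMat w) := by
  refine ⟨exists_inT_map_colSpace_eq W hW, ?_⟩
  rintro ω ω' hω hω' ⟨b₁, b₂, hu₁, ht₁, hu₂, ht₂, hb⟩ ⟨b₁', b₂', hu₁', ht₁', hu₂', ht₂', hb'⟩
  refine hω.exists_eq_mul_permMat hω' fun k => ?_
  rw [← finrank_map_fromBlocks_inf_flagSpace hu₁ ht₁ hu₂ ht₂, ← hb, hb',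
    finrank_map_fromBlocks_inf_flagSpace hu₁' ht₁' hu₂' ht₂']
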